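/- arXiv:2004.13257 — 9 statements merged into one kernel-verified Lean document; each statement's English description precedes it below -/
import Mathlib

section
/- Let z ∈ ℝⁿ and let s be an integer with 0 < s < n. A vector π ∈ ℝⁿ belongs to Π_S(z), the set of Euclidean projections of z onto S = {x ∈ ℝⁿ : ‖x‖₀ ≤ s}, if and only if there exists an index set T ⊆ {1,…,n} with |T| = s such that |z_i| ≥ |z_j| for all i ∈ T and j ∉ T, π_i = z_i for all i ∈ T, and π_j = 0 for all j ∉ T. -/
open scoped BigOperators
open Filter Topology

noncomputable section

/-- `E n` is Euclidean space `ℝⁿ`. -/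
abbrev E (n : ℕ) : Type := EuclideanSpace ℝ (Fin n)

/-- Pack a plain function as a vector of the corresponding Euclidean space. -/
def toE {ι : Type} (v : ι → ℝ) : EuclideanSpace ℝ ι := (WithLp.equiv 2 _).symm v

/-- `‖x‖₀`, the number of nonzero components of `x`. -/
def norm0 {n : ℕ} (x : E n) : ℕ := (Finset.univ.filter fun i => x i ≠ 0).card

/-- `supp(x)`, the support of `x`. -/
def spt {n : ℕ} (x : E n) : Finset (Fin n) := Finset.univ.filter fun i => x i ≠ 0

/-- The sparse constraint set `S = {x : ‖x‖₀ ≤ s}`. -/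
def Sset (n s : ℕ) : Set (E n) := {x | norm0 x ≤ s}

/-- The (set-valued) Euclidean projection onto `S`: `Π_S(z) = argmin_{w ∈ S} ‖z - w‖²`. -/
def projS (n s : ℕ) (z : E n) : Set (E n) :=
  {p | p ∈ Sset n s ∧ ∀ w ∈ Sset n s, ‖z - p‖ ^ 2 ≤ ‖z - w‖ ^ 2}

/-- `∇ₓL(x,y) = ∇f(x) - (∇h(x))ᵀ y`. -/
def gradL {n m : ℕ} (f : E n → ℝ) (h : E n → E m) (x : E n) (y : E m) : E n :=
  gradient f x - ∑ k, y k • gradient (fun u => h u k) x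

/-- `x` is a strong `β`-Lagrangian stationary point with multiplier `y`. -/
def StrongLS {n m : ℕ} (s : ℕ) (f : E n → ℝ) (h : E n → E m) (β : ℝ)
    (x : E n) (y : E m) : Prop :=
  x ∈ projS n s (x - β • gradL f h x y) ∧ h x = 0

/-- `𝕋(x,y;β)`: collection of sparse projection index sets of `u = x - β ∇ₓL(x,y)`. -/
def Tsets {n m : ℕ} (s : ℕ) (f : E n → ℝ) (h : E n → E m) (β : ℝ) (x : E n) (y : E m) :
    Set (Finset (Fin n)) :=
  {T | T.card = s ∧ ∀ i ∈ T, ∀ j ∉ T,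
    |(x - β • gradL f h x y) j| ≤ |(x - β • gradL f h x y) i|}

/-- The Lagrangian-equation map `F(x,y;T) = ((∇ₓL(x,y))_T ; x_{Tᶜ} ; -h(x)) ∈ ℝ^{n+m}`
(with the first two blocks interleaved in the natural coordinate order). -/
def Fvec {n m : ℕ} (f : E n → ℝ) (h : E n → E m) (T : Finset (Fin n)) (x : E n) (y : E m) :
    EuclideanSpace ℝ (Fin n ⊕ Fin m) :=
  toE (Sum.elim (fun i => if i ∈ T then gradL f h x y i else x i) (fun k => -(h x k)))

/-- Hessian matrix of a scalar function on `ℝⁿ`. -/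
def hess {n : ℕ} (g : E n → ℝ) (x : E n) : Matrix (Fin n) (Fin n) ℝ :=
  Matrix.of fun i j =>
    fderiv ℝ (fun u => fderiv ℝ g u (EuclideanSpace.single j 1)) x (EuclideanSpace.single i 1)

/-- `∇²ₓₓ L(x,y) = ∇²f(x) - Σ_k y_k ∇²h_k(x)`. -/
def hessL {n m : ℕ} (f : E n → ℝ) (h : E n → E m) (x : E n) (y : E m) :
    Matrix (Fin n) (Fin n) ℝ :=
  hess f x - ∑ k, y k • hess (fun u => h u k) x

/-- `∇h(x)`: the `m × n` matrix whose rows are `∇h_k(x)ᵀ`. -/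
def gradh {n m : ℕ} (h : E n → E m) (x : E n) : Matrix (Fin m) (Fin n) ℝ :=
  Matrix.of fun k j => gradient (fun u => h u k) x j

/-- The Jacobian `∇_{(x,y)} F(x,y;T)`, with block rows
`[(∇²ₓₓL)_{T,·}, -(∇_T h)ᵀ]`, `[I_{Tᶜ,·}, 0]`, `[-∇h, 0]`
(the first two row blocks interleaved in natural coordinate order). -/
def JacF {n m : ℕ} (f : E n → ℝ) (h : E n → E m) (T : Finset (Fin n)) (x : E n) (y : E m) :
    Matrix (Fin n ⊕ Fin m) (Fin n ⊕ Fin m) ℝ :=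
  Matrix.of fun r c =>
    match r, c with
    | Sum.inl i, Sum.inl j =>
        if i ∈ T then hessL f h x y i j else (if i = j then (1 : ℝ) else 0)
    | Sum.inl i, Sum.inr k => if i ∈ T then -(gradh h x k i) else 0
    | Sum.inr k, Sum.inl j => -(gradh h x k j)
    | Sum.inr _, Sum.inr _ => 0

/-- The reduced Jacobian `G(x,y;T) = [[(∇²ₓₓL)_{T,T}, -(∇_T h)ᵀ], [-∇_T h, 0]]`. -/
def Gmat {n m : ℕ} (f : E n → ℝ) (h : E n → E m) (T : Finset (Fin n)) (x : E n) (y : E m) :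
    Matrix ({i // i ∈ T} ⊕ Fin m) ({i // i ∈ T} ⊕ Fin m) ℝ :=
  Matrix.of fun r c =>
    match r, c with
    | Sum.inl i, Sum.inl j => hessL f h x y i.1 j.1
    | Sum.inl i, Sum.inr k => -(gradh h x k i.1)
    | Sum.inr k, Sum.inl j => -(gradh h x k j.1)
    | Sum.inr _, Sum.inr _ => 0

/-- The full Hessian `∇²L(x,y) = [[∇²ₓₓL, -(∇h)ᵀ], [-∇h, 0]]`. -/
def fullHess {n m : ℕ} (f : E n → ℝ) (h : E n → E m) (x : E n) (y : E m) :
    Matrix (Fin n ⊕ Fin m) (Fin n ⊕ Fin m) ℝ :=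
  Matrix.of fun r c =>
    match r, c with
    | Sum.inl i, Sum.inl j => hessL f h x y i j
    | Sum.inl i, Sum.inr k => -(gradh h x k i)
    | Sum.inr k, Sum.inl j => -(gradh h x k j)
    | Sum.inr _, Sum.inr _ => 0

/-- Euclidean norm of the concatenated vector `z = (x; y) ∈ ℝ^{n+m}`. -/
def zNorm {n m : ℕ} (x : E n) (y : E m) : ℝ := Real.sqrt (‖x‖ ^ 2 + ‖y‖ ^ 2)

/-- `|x|_(s)`, the `s`-th largest component of `(|x_1|, …, |x_n|)`. -/
def kthLargest {n : ℕ} (x : E n) (s : ℕ) : ℝ :=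
  (((Finset.univ : Finset (Fin n)).val.map fun i => |x i|).sort (· ≤ ·)).getD (n - s) 0

/-- The stationarity measure `η_β(x,y;T)`. -/
def eta {n m : ℕ} (s : ℕ) (f : E n → ℝ) (h : E n → E m) (β : ℝ)
    (T : Finset (Fin n)) (x : E n) (y : E m) : ℝ :=
  ‖Fvec f h T x y‖ +
    (if hne : (Tᶜ : Finset (Fin n)).Nonempty then
      (Tᶜ).sup' hne fun i => max (|gradL f h x y i| - kthLargest x s / β) 0
    else 0)

/-- The Lagrange–Newton iteration: `T_k ∈ 𝕋(x^k, y^k; β)` and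
`∇_{(x,y)}F(x^k, y^k; T_k) (z^{k+1} - z^k) = -F(x^k, y^k; T_k)`. -/
def NewtonSeq {n m : ℕ} (s : ℕ) (f : E n → ℝ) (h : E n → E m) (β : ℝ)
    (xk : ℕ → E n) (yk : ℕ → E m) (Tk : ℕ → Finset (Fin n)) : Prop :=
  ∀ k : ℕ, Tk k ∈ Tsets s f h β (xk k) (yk k) ∧
    ∀ idx, (JacF f h (Tk k) (xk k) (yk k)).mulVec
        (Sum.elim (fun i => xk (k+1) i - xk k i) (fun j => yk (k+1) j - yk k j)) idx
      = -(Fvec f h (Tk k) (xk k) (yk k) idx)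

/-- distance formula for a vector supported in `T`. -/
theorem aux_dist {n : ℕ} (z p : E n) (T : Finset (Fin n)) (hp : ∀ j ∉ T, p j = 0) :
    ‖z - p‖ ^ 2 = ∑ i, z i ^ 2 - ∑ i ∈ T, z i ^ 2 + ∑ i ∈ T, (z i - p i) ^ 2 := by
  rw [EuclideanSpace.real_norm_sq_eq, ← Finset.sum_add_sum_compl T (fun i => z i ^ 2),
    ← Finset.sum_add_sum_compl T]
  have h : ∑ i ∈ Tᶜ, (z - p) i ^ 2 = ∑ i ∈ Tᶜ, z i ^ 2 := by
    apply Finset.sum_congr rfl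
    intro i hi
    simp [hp i (by simpa using hi)]
  rw [h]
  simp only [PiLp.sub_apply]
  ring

theorem aux_mem {n s : ℕ} (w : E n) (T : Finset (Fin n)) (hT : T.card = s)
    (hw : ∀ j ∉ T, w j = 0) : w ∈ Sset n s := by
  show (Finset.univ.filter fun i => w i ≠ 0).card ≤ s
  rw [← hT]
  apply Finset.card_le_card
  intro i hi
  by_contra h
  simp [hw i h] at hi

theorem aux_ex {n s : ℕ} (hsn : s < n) (w : E n) (hw : w ∈ Sset n s) :
    ∃ T : Finset (Fin n), T.card = s ∧ ∀ j ∉ T, w j = 0 := by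
  obtain ⟨T, h1, h2⟩ := Finset.exists_superset_card_eq
    (s := Finset.univ.filter fun i => w i ≠ 0) (n := s) hw (by simpa using hsn.le)
  refine ⟨T, h2, fun j hj => ?_⟩
  by_contra h
  exact hj (h1 (by simp [h]))

/-- comparison of the projection with truncations of `z`. -/
theorem aux_cmp {n s : ℕ} (z p : E n) (hp : p ∈ projS n s z) (T : Finset (Fin n))
    (hT : T.card = s) : ‖z - p‖ ^ 2 ≤ ∑ i, z i ^ 2 - ∑ i ∈ T, z i ^ 2 := by
  let w : E n := WithLp.toLp 2 (fun i => if i ∈ T then z i else 0)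
  have hw : ∀ j ∉ T, w j = 0 := fun j hj => by simp [w, hj]
  have h := hp.2 w (aux_mem w T hT hw)
  rw [aux_dist z w T hw] at h
  have h0 : ∑ i ∈ T, (z i - w i) ^ 2 = 0 := by
    apply Finset.sum_eq_zero
    intro i hi
    simp [w, hi]
  linarith

theorem aux_top {n : ℕ} (f : Fin n → ℝ) (T W : Finset (Fin n)) (hc : W.card = T.card)
    (h : ∀ i ∈ T, ∀ j ∉ T, f j ≤ f i) : ∑ i ∈ W, f i ≤ ∑ i ∈ T, f i := by
  have hcard : (W \ T).card = (T \ W).card := Finset.card_sdiff_comm hc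
  have key : ∑ i ∈ W \ T, f i ≤ ∑ i ∈ T \ W, f i := by
    rcases (T \ W).eq_empty_or_nonempty with he | hne
    · rw [he, Finset.card_empty, Finset.card_eq_zero] at hcard
      rw [hcard, he]
    · obtain ⟨m, hm, hmin⟩ := Finset.exists_min_image (T \ W) f hne
      calc ∑ i ∈ W \ T, f i ≤ (W \ T).card • f m :=
            Finset.sum_le_card_nsmul _ _ _ fun j hj =>
              h m (Finset.mem_sdiff.1 hm).1 j (Finset.mem_sdiff.1 hj).2
        _ = (T \ W).card • f m := by rw [hcard]
        _ ≤ _ := Finset.card_nsmul_le_sum _ _ _ hmin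
  rw [← Finset.sum_inter_add_sum_sdiff W T f, ← Finset.sum_inter_add_sum_sdiff T W f,
    Finset.inter_comm T W]
  linarith

/-- characterization of the projection onto the sparse set `S`. -/
theorem statement_0 {n s : ℕ} (hs0 : 0 < s) (hsn : s < n) (z p : E n) :
    p ∈ projS n s z ↔
      ∃ T : Finset (Fin n), T.card = s ∧
        (∀ i ∈ T, ∀ j ∉ T, |z j| ≤ |z i|) ∧
        (∀ i ∈ T, p i = z i) ∧ (∀ j ∉ T, p j = 0) := by
  constructor
  · intro hp
    obtain ⟨T, hT, hp0⟩ := aux_ex hsn p hp.1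
    have hd := aux_dist z p T hp0
    have h0 : ∑ i ∈ T, (z i - p i) ^ 2 = 0 := by
      have := aux_cmp z p hp T hT
      have := Finset.sum_nonneg (s := T) (f := fun i => (z i - p i) ^ 2)
        (fun i _ => sq_nonneg _)
      linarith
    refine ⟨T, hT, ?_, ?_, hp0⟩
    · intro i hi j hj
      have hj' : j ∉ T.erase i := fun h => hj (Finset.mem_of_mem_erase h)
      have hc := aux_cmp z p hp (insert j (T.erase i)) (by
        rw [Finset.card_insert_of_notMem hj', Finset.card_erase_add_one hi, hT])
      rw [Finset.sum_insert hj'] at hc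
      have he := Finset.add_sum_erase T (fun i => z i ^ 2) hi
      simp only at he
      exact sq_le_sq.1 (by linarith)
    · intro i hi
      have := (Finset.sum_eq_zero_iff_of_nonneg (fun i _ => sq_nonneg _)).1 h0 i hi
      have := pow_eq_zero_iff (two_ne_zero) |>.1 this
      linarith
  · rintro ⟨T, hT, hz, h1, h2⟩
    refine ⟨aux_mem p T hT h2, fun w hw => ?_⟩
    obtain ⟨W, hW, hw0⟩ := aux_ex hsn w hw
    rw [aux_dist z p T h2, aux_dist z w W hw0]
    have ht := aux_top (fun i => z i ^ 2) T W (hW.trans hT.symm)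
      (fun i hi j hj => sq_le_sq.2 (hz i hi j hj))
    have h0 : ∑ i ∈ T, (z i - p i) ^ 2 = 0 :=
      Finset.sum_eq_zero fun i hi => by simp [h1 i hi]
    have := Finset.sum_nonneg (s := W) (f := fun i => (z i - w i) ^ 2)
      (fun i _ => sq_nonneg _)
    linarith

end
end

section
/- Let x ∈ ℝⁿ satisfy ‖x‖₀ ≤ s, let Γ = supp(x), and suppose the m×|Γ| matrix ∇_Γ h(x) (the columns of ∇h(x) indexed by Γ) has rank m. Then for any index set J ⊆ {1,…,n} with |J| = s and Γ ⊆ J, the vectors ∇h₁(x), …, ∇h_m(x) together with the standard basis vectors e_j for j ∈ Jᶜ are linearly independent in ℝⁿ. -/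
open scoped BigOperators
open Filter Topology

noncomputable section

/-- under the rank condition on `∇_Γ h(x)`, the gradients `∇h_k(x)` together with
the standard basis vectors `e_j`, `j ∈ Jᶜ`, are linearly independent. -/
theorem statement_2 {n m s : ℕ} (hs0 : 0 < s) (hsn : s < n)
    (h : E n → E m) (hh : ContDiff ℝ 2 h)
    (x : E n) (hx : norm0 x ≤ s)
    (hrank : (Matrix.of fun (k : Fin m) (i : {i // i ∈ spt x}) => gradh h x k i.1).rank = m)
    (J : Finset (Fin n)) (hJcard : J.card = s) (hJ : spt x ⊆ J) :
    LinearIndependent ℝ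
      (Sum.elim (fun k : Fin m => gradient (fun u => h u k) x)
        (fun j : {j // j ∈ Jᶜ} => (EuclideanSpace.single j.1 1 : E n))) := by
  have hrows : LinearIndependent ℝ
      (Matrix.of fun (k : Fin m) (i : {i // i ∈ spt x}) => gradh h x k i.1).row := by
    rw [linearIndependent_iff_card_eq_finrank_span, Set.finrank, ← Matrix.rank_eq_finrank_span_row, hrank]
    simp
  rw [Fintype.linearIndependent_iff] at hrows ⊢
  intro g hg
  have hcoord : ∀ i : Fin n, (∑ k : Fin m, g (Sum.inl k) * gradient (fun u => h u k) x i) +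
      ∑ j : {j // j ∈ Jᶜ}, g (Sum.inr j) * (if i = j.1 then 1 else 0) = 0 := by
    intro i
    have := congrArg (fun v : E n => v i) hg
    simpa [Fintype.sum_sum_type, Pi.single_apply] using this
  have hl : ∀ k : Fin m, g (Sum.inl k) = 0 := by
    apply hrows (fun k => g (Sum.inl k))
    funext i
    have h1 := hcoord i.1
    rw [Finset.sum_eq_zero (s := (Finset.univ : Finset {j // j ∈ Jᶜ})), add_zero] at h1
    · simpa [Finset.sum_apply, gradh, Matrix.row] using h1
    · intro j _
      have hne : i.1 ≠ j.1 := by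
        intro he
        have := hJ i.2
        rw [he] at this
        exact (Finset.mem_compl.mp j.2) this
      simp [hne]
  rintro (k | j)
  · exact hl k
  · have h1 := hcoord j.1
    rw [Finset.sum_eq_zero (fun k _ => by rw [hl k, zero_mul]), zero_add,
      Finset.sum_eq_single j] at h1
    · simpa using h1
    · intro b _ hb
      have : j.1 ≠ b.1 := fun he => hb (Subtype.ext he.symm)
      simp [this]
    · simp

end
end

section
/- Suppose x* is a local minimizer of the problem min f(x) subject to h(x) = 0 and ‖x‖₀ ≤ s, and suppose rank(∇_{Γ*} h(x*)) = m where Γ* = supp(x*). Then there exists a unique y* ∈ ℝᵐ such that, for every β ∈ (0, β̂), x* is a strong β-Lagrangian stationary point with multiplier y*, where β̂ = |x*|_(s) / max_{j ∉ Γ*} |q*_j| if ‖x*‖₀ = s and q*_{(Γ*)ᶜ} ≠ 0, and β̂ = +∞ otherwise, with q* = ∇_x L(x*, y*). -/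
open scoped BigOperators
open Filter Topology

noncomputable section

theorem aux_getElem_mono (l : List ℝ) (hl : l.Pairwise (· ≤ ·)) (a b : ℕ) (hab : a ≤ b)
    (hb : b < l.length) : l[a]'(by omega) ≤ l[b] := by
  rcases hab.eq_or_lt with rfl | h
  · exact le_rfl
  · exact List.pairwise_iff_getElem.1 hl a b (by omega) hb h

theorem aux_countP_lt (l : List ℝ) (hl : l.Pairwise (· ≤ ·)) (k : ℕ) (hk : k < l.length) :
    l.countP (fun a => decide (a < l[k])) ≤ k := by
  have h1 : l.countP (fun a => decide (a < l[k])) =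
      (l.take k).countP (fun a => decide (a < l[k])) +
      (l.drop k).countP (fun a => decide (a < l[k])) := by
    rw [← List.countP_append, List.take_append_drop]
  have h2 : (l.drop k).countP (fun a => decide (a < l[k])) = 0 := by
    rw [List.countP_eq_zero]
    intro a ha
    obtain ⟨j, hj, rfl⟩ := List.mem_iff_getElem.1 ha
    rw [List.length_drop] at hj
    have := aux_getElem_mono l hl k (k + j) (by omega) (by omega)
    simpa using this
  have h3 := List.countP_le_length (p := fun a => decide (a < l[k])) (l := l.take k)
  have h4 := List.length_take_le k l
  omega

theorem aux_countP_le (l : List ℝ) (hl : l.Pairwise (· ≤ ·)) (k : ℕ) (hk : k < l.length) :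
    k + 1 ≤ l.countP (fun a => decide (a ≤ l[k])) := by
  have h1 : (l.take (k+1)).countP (fun a => decide (a ≤ l[k])) = (l.take (k+1)).length := by
    rw [List.countP_eq_length]
    intro a ha
    obtain ⟨j, hj, rfl⟩ := List.mem_iff_getElem.1 ha
    rw [List.length_take] at hj
    have := aux_getElem_mono l hl j k (by omega) (by omega)
    simpa using this
  have h2 := (List.take_sublist (k+1) l).countP_le (p := fun a => decide (a ≤ l[k]))
  rw [h1, List.length_take] at h2
  omega

theorem aux_kth {n s : ℕ} (hs0 : 0 < s) (hsn : s < n) (x : E n) (hx : norm0 x = s) :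
    0 < kthLargest x s ∧ ∀ i ∈ spt x, kthLargest x s ≤ |x i| := by
  set M : Multiset ℝ := ((Finset.univ : Finset (Fin n)).val.map fun i => |x i|) with hM
  set l := M.sort (· ≤ ·) with hl
  have hsort : l.Pairwise (· ≤ ·) := Multiset.pairwise_sort M _
  have hlen : l.length = n := by simp [hl, hM]
  have hk : n - s < l.length := by omega
  have hkth : kthLargest x s = l[n - s] := by
    unfold kthLargest
    exact List.getD_eq_getElem _ _ hk
  have hcount : ∀ (p : ℝ → Prop) [DecidablePred p],
      l.countP (fun a => decide (p a)) = (Finset.univ.filter fun i => p |x i|).card := by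
    intro p _
    have h1 : Multiset.countP p (l : Multiset ℝ) = Multiset.countP p M := by
      rw [hl, Multiset.sort_eq]
    rw [Multiset.coe_countP] at h1
    rw [h1, hM, Multiset.countP_map]
    rfl
  have hzero : (Finset.univ.filter fun i => ¬ (x i ≠ 0)).card = n - s := by
    have := Finset.card_filter_add_card_filter_not (s := (Finset.univ : Finset (Fin n)))
      (fun i => x i ≠ 0)
    unfold norm0 at hx
    rw [hx, Finset.card_univ, Fintype.card_fin] at this
    omega
  rw [hkth]
  have hpos : 0 < l[n - s] := by
    by_contra hneg
    have h1 := aux_countP_le l hsort (n - s) hk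
    rw [hcount] at h1
    have h2 : (Finset.univ.filter fun i => |x i| ≤ l[n - s]).card ≤
        (Finset.univ.filter fun i => ¬ (x i ≠ 0)).card := by
      apply Finset.card_le_card
      intro i
      simp only [Finset.mem_filter, Finset.mem_univ, true_and, not_not]
      intro hi
      have := abs_nonneg (x i)
      exact abs_eq_zero.1 (by linarith)
    omega
  refine ⟨hpos, ?_⟩
  intro i hi
  by_contra hlt
  push Not at hlt
  have h1 := aux_countP_lt l hsort (n - s) hk
  rw [hcount] at h1
  have hi' : x i ≠ 0 := by simpa [spt] using hi
  have h2 : (insert i (Finset.univ.filter fun i => ¬ (x i ≠ 0))).card ≤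
      (Finset.univ.filter fun i => |x i| < l[n - s]).card := by
    apply Finset.card_le_card
    intro j
    simp only [Finset.mem_insert, Finset.mem_filter, Finset.mem_univ, true_and, not_not]
    rintro (rfl | hj)
    · exact hlt
    · rw [hj, abs_zero]; exact hpos
  rw [Finset.card_insert_of_notMem (by simpa using hi')] at h2
  omega

theorem aux_grad {n : ℕ} (g : E n → ℝ) (x : E n) (i : Fin n) :
    gradient g x i = fderiv ℝ g x (EuclideanSpace.single i 1) := by
  rw [← inner_gradient_left, EuclideanSpace.inner_single_right]
  simp

theorem aux_gradL {n m : ℕ} (f : E n → ℝ) (h : E n → E m) (x : E n) (y : E m) (i : Fin n) :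
    gradL f h x y i = gradient f x i - ∑ k, y k * gradh h x k i := by
  simp [gradL, gradh]

theorem aux_inj {n m : ℕ} (h : E n → E m) (xs : E n)
    (hrank : (Matrix.of fun (k : Fin m) (i : {i // i ∈ spt xs}) => gradh h xs k i.1).rank = m)
    (c : Fin m → ℝ) (hc : ∀ i ∈ spt xs, ∑ k, c k * gradh h xs k i = 0) : c = 0 := by
  rw [Matrix.rank_eq_finrank_span_row] at hrank
  have hli := linearIndependent_iff_card_eq_finrank_span.2
    ((Fintype.card_fin m).trans hrank.symm)
  rw [Fintype.linearIndependent_iff] at hli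
  funext k
  refine hli c ?_ k
  funext i
  simpa [Finset.sum_apply] using hc i.1 i.2

theorem aux_unique {n m : ℕ} (f : E n → ℝ) (h : E n → E m) (xs : E n)
    (hrank : (Matrix.of fun (k : Fin m) (i : {i // i ∈ spt xs}) => gradh h xs k i.1).rank = m)
    (y y' : E m) (hy : ∀ i ∈ spt xs, gradL f h xs y i = 0)
    (hy' : ∀ i ∈ spt xs, gradL f h xs y' i = 0) : y = y' := by
  have := aux_inj h xs hrank (fun k => y k - y' k) (by
    intro i hi
    have h1 := hy i hi
    have h2 := hy' i hi
    rw [aux_gradL] at h1 h2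
    simp only [sub_mul, Finset.sum_sub_distrib]
    linarith)
  ext k
  have := congrFun this k
  simp only [Pi.zero_apply] at this
  linarith

/-- Coordinate mask onto `T`. -/
def auxMask {n : ℕ} (T : Finset (Fin n)) : E n →L[ℝ] E n :=
  LinearMap.toContinuousLinearMap
    { toFun := fun u => WithLp.toLp 2 (fun i => if i ∈ T then u i else 0)
      map_add' := by
        intro u v
        ext i
        by_cases hi : i ∈ T <;> simp [hi]
      map_smul' := by
        intro c v
        ext i
        by_cases hi : i ∈ T <;> simp [hi] }

theorem auxMask_apply {n : ℕ} (T : Finset (Fin n)) (u : E n) (i : Fin n) :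
    auxMask T u i = if i ∈ T then u i else 0 := rfl

theorem aux_norm0_le {n : ℕ} (T : Finset (Fin n)) (u : E n) (hu : ∀ i ∉ T, u i = 0) :
    norm0 u ≤ T.card := by
  apply Finset.card_le_card
  intro i hi
  by_contra hT
  exact (Finset.mem_filter.1 hi).2 (hu i hT)

theorem aux_kkt {n m s : ℕ} (f : E n → ℝ) (h : E n → E m)
    (hf : ContDiff ℝ 2 f) (hh : ContDiff ℝ 2 h) (xs : E n) (hfeas : h xs = 0)
    (hloc : ∃ δ > 0, ∀ x : E n, ‖x - xs‖ < δ → h x = 0 → norm0 x ≤ s → f xs ≤ f x)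
    (hrank : (Matrix.of fun (k : Fin m) (i : {i // i ∈ spt xs}) => gradh h xs k i.1).rank = m)
    (T : Finset (Fin n)) (hT : spt xs ⊆ T) (hTs : T.card ≤ s) :
    ∃ y : E m, ∀ i ∈ T, gradL f h xs y i = 0 := by
  have hfix : auxMask T xs = xs := by
    ext i
    rw [auxMask_apply]
    split_ifs with hi
    · rfl
    · by_contra hne
      exact hi (hT (by simpa [spt] using Ne.symm hne))
  have hsingle : ∀ i ∈ T, auxMask T (EuclideanSpace.single i (1:ℝ)) = EuclideanSpace.single i 1 := by
    intro i hi
    ext j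
    rw [auxMask_apply]
    split_ifs with hj
    · rfl
    · have : j ≠ i := fun e => hj (e ▸ hi)
      simp [this]
  have hmin : IsLocalExtrOn (fun u => f (auxMask T u))
      {u | ∀ k, h (auxMask T u) k = h (auxMask T xs) k} xs := by
    left
    obtain ⟨δ, hδ, hmin⟩ := hloc
    have hcont : Tendsto (fun u => auxMask T u) (𝓝 xs) (𝓝 xs) := by
      have := (auxMask T).continuous.tendsto xs
      rwa [hfix] at this
    have hev := hcont.eventually (Metric.ball_mem_nhds xs hδ)
    filter_upwards [mem_nhdsWithin_of_mem_nhds hev, self_mem_nhdsWithin] with u hu hu2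
    change f (auxMask T xs) ≤ f (auxMask T u)
    rw [hfix]
    refine hmin _ ?_ ?_ ?_
    · have : dist (auxMask T u) xs < δ := hu
      rwa [dist_eq_norm] at this
    · ext k
      have := hu2 k
      rw [this, hfix, hfeas]
    · refine (aux_norm0_le T _ ?_).trans hTs
      intro i hi
      rw [auxMask_apply, if_neg hi]
  have hfs : HasStrictFDerivAt f (fderiv ℝ f xs) (auxMask T xs) := by
    rw [hfix]
    exact hf.contDiffAt.hasStrictFDerivAt (by norm_num)
  have hhs : ∀ k, HasStrictFDerivAt (fun u => h u k) (fderiv ℝ (fun u => h u k) xs)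
      (auxMask T xs) := by
    intro k
    rw [hfix]
    have : ContDiff ℝ 2 (fun u => h u k) := contDiff_euclidean.1 hh k
    exact this.contDiffAt.hasStrictFDerivAt (by norm_num)
  obtain ⟨Λ, Λ₀, hne, heq⟩ := hmin.exists_multipliers_of_hasStrictFDerivAt
    (f := fun k u => h (auxMask T u) k)
    (fun k => (hhs k).comp xs (auxMask T).hasStrictFDerivAt)
    (hfs.comp xs (auxMask T).hasStrictFDerivAt)
  have hcoord : ∀ i ∈ T, ∑ k, Λ k * gradh h xs k i + Λ₀ * gradient f xs i = 0 := by
    intro i hi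
    have := congrArg (fun L => L (EuclideanSpace.single i (1:ℝ))) heq
    simp only [_root_.add_apply, _root_.sum_apply,
      _root_.smul_apply, ContinuousLinearMap.comp_apply, hsingle i hi, smul_eq_mul,
      _root_.zero_apply] at this
    simpa only [gradh, Matrix.of_apply, aux_grad] using this
  have hΛ₀ : Λ₀ ≠ 0 := by
    intro h0
    apply hne
    have : Λ = 0 := aux_inj h xs hrank Λ (by
      intro i hi
      have := hcoord i (hT hi)
      rw [h0, zero_mul, add_zero] at this
      exact this)
    rw [this, h0]
    rfl
  refine ⟨WithLp.toLp 2 (fun k => -(Λ k / Λ₀)), ?_⟩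
  intro i hi
  rw [aux_gradL]
  have h1 := hcoord i hi
  have h2 : ∑ k, -(Λ k / Λ₀) * gradh h xs k i = -(∑ k, Λ k * gradh h xs k i) / Λ₀ := by
    rw [neg_div, Finset.sum_div, ← Finset.sum_neg_distrib]
    refine Finset.sum_congr rfl fun k _ => ?_
    ring
  change gradient f xs i - ∑ k, -(Λ k / Λ₀) * gradh h xs k i = 0
  rw [h2, show -(∑ k, Λ k * gradh h xs k i) = Λ₀ * gradient f xs i by linarith]
  field_simp
  ring

theorem aux_stat {n s : ℕ} (x q : E n) (β : ℝ) (hβ : 0 < β)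
    (hp : x ∈ projS n s (x - β • q)) : ∀ i ∈ spt x, q i = 0 := by
  intro i hi
  by_contra hq
  obtain ⟨hxS, hmin⟩ := hp
  have hw : auxMask (spt x) (x - β • q) ∈ Sset n s := by
    refine (aux_norm0_le (spt x) _ ?_).trans hxS
    intro j hj
    rw [auxMask_apply, if_neg hj]
  have h1 := hmin _ hw
  rw [EuclideanSpace.real_norm_sq_eq, EuclideanSpace.real_norm_sq_eq] at h1
  refine absurd h1 (not_le.2 ?_)
  have hval : ∀ j, (x - β • q - auxMask (spt x) (x - β • q)) j =
      if j ∈ spt x then 0 else - (β * q j) := by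
    intro j
    rw [PiLp.sub_apply, auxMask_apply]
    split_ifs with hj
    · ring
    · have : x j = 0 := by simpa [spt] using hj
      simp [this]
  have hval2 : ∀ j, (x - β • q - x) j = - (β * q j) := by
    intro j
    simp
  apply Finset.sum_lt_sum
  · intro j _
    rw [hval, hval2]
    split_ifs
    · nlinarith [sq_nonneg (β * q j)]
    · exact le_rfl
  · refine ⟨i, Finset.mem_univ _, ?_⟩
    rw [hval, hval2, if_pos hi]
    have : β * q i ≠ 0 := mul_ne_zero hβ.ne' hq
    have := pow_pos (abs_pos.2 this) 2
    rw [sq_abs] at this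
    simpa using this

theorem aux_proj {n s : ℕ} (hs0 : 0 < s) (hsn : s < n) (x q : E n) (β : ℝ) (hβ : 0 < β)
    (hx : norm0 x = s) (hq : ∀ i ∈ spt x, q i = 0)
    (hb : ∀ j ∉ spt x, β * |q j| < kthLargest x s) : x ∈ projS n s (x - β • q) := by
  obtain ⟨hκ, hκle⟩ := aux_kth hs0 hsn x hx
  set κ := kthLargest x s
  refine ⟨hx.le, ?_⟩
  intro w hw
  rw [EuclideanSpace.real_norm_sq_eq, EuclideanSpace.real_norm_sq_eq]
  have hpt : ∀ i, ((x - β • q - x) i) ^ 2 ≤ ((x - β • q - w) i) ^ 2 +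
      κ ^ 2 * ((if w i ≠ 0 then (1:ℝ) else 0) - (if x i ≠ 0 then (1:ℝ) else 0)) := by
    intro i
    simp only [PiLp.sub_apply, PiLp.smul_apply, smul_eq_mul]
    by_cases hxi : x i = 0
    · have hb' := hb i (by simpa [spt] using hxi)
      have hsq : (β * q i) ^ 2 ≤ κ ^ 2 := by
        rw [← sq_abs, abs_mul, abs_of_pos hβ]
        exact pow_le_pow_left₀ (by positivity) hb'.le 2
      by_cases hwi : w i = 0
      · simp [hxi, hwi]
      · simp only [hxi, hwi, ne_eq, not_true_eq_false, not_false_eq_true, if_true, if_false]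
        nlinarith [sq_nonneg (0 - β * q i - w i)]
    · have hmem : i ∈ spt x := by simpa [spt] using hxi
      have hqi := hq i hmem
      have hsq : κ ^ 2 ≤ x i ^ 2 := by
        rw [← sq_abs (x i)]
        exact pow_le_pow_left₀ hκ.le (hκle i hmem) 2
      by_cases hwi : w i = 0
      · simp [hxi, hwi, hqi]
        linarith
      · simp [hxi, hwi, hqi]
        positivity
  refine (Finset.sum_le_sum fun i _ => hpt i).trans ?_
  rw [Finset.sum_add_distrib, ← Finset.mul_sum, Finset.sum_sub_distrib, Finset.sum_boole,
    Finset.sum_boole]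
  have h1 : ((Finset.univ.filter fun i => w i ≠ 0).card : ℝ) ≤ s := by
    exact Nat.cast_le.2 hw
  have h2 : ((Finset.univ.filter fun i => x i ≠ 0).card : ℝ) = s := by
    exact congrArg Nat.cast hx
  rw [h2]
  nlinarith [sq_nonneg κ]

/-- Theorem 2.4: first-order necessary optimality condition.  The condition
`β ∈ (0, β̂)` is encoded as: if `‖x*‖₀ = s` then `β · |q*_j| < |x*|_(s)` for every `j ∉ Γ*`
(which is equivalent to `β · max_{j ∉ Γ*} |q*_j| < |x*|_(s)`, i.e. `β < β̂`, and is vacuous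
in the case `β̂ = +∞`). -/
theorem statement_3 {n m s : ℕ} (hs0 : 0 < s) (hsn : s < n)
    (f : E n → ℝ) (h : E n → E m) (hf : ContDiff ℝ 2 f) (hh : ContDiff ℝ 2 h)
    (xs : E n) (hfeas : h xs = 0) (hxs : norm0 xs ≤ s)
    (hloc : ∃ δ > 0, ∀ x : E n, ‖x - xs‖ < δ → h x = 0 → norm0 x ≤ s → f xs ≤ f x)
    (hrank : (Matrix.of fun (k : Fin m) (i : {i // i ∈ spt xs}) => gradh h xs k i.1).rank = m) :
    ∃! ys : E m, ∀ β : ℝ, 0 < β →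
      (norm0 xs = s → ∀ j ∉ spt xs, β * |gradL f h xs ys j| < kthLargest xs s) →
      StrongLS s f h β xs ys := by
  obtain ⟨y, hy⟩ := aux_kkt f h hf hh xs hfeas hloc hrank (spt xs) (Finset.Subset.refl _) hxs
  refine ⟨y, ?_, ?_⟩
  · intro β hβ hb
    refine ⟨?_, hfeas⟩
    by_cases hx : norm0 xs = s
    · exact aux_proj hs0 hsn xs _ β hβ hx hy (hb hx)
    · have hzero : gradL f h xs y = 0 := by
        ext j
        obtain ⟨y', hy'⟩ := aux_kkt (s := s) f h hf hh xs hfeas hloc hrank (insert j (spt xs))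
          (Finset.subset_insert _ _) (by
            have h1 := Finset.card_insert_le j (spt xs)
            have h2 : (spt xs).card = norm0 xs := rfl
            omega)
        have : y = y' := aux_unique f h xs hrank y y' hy
          (fun i hi => hy' i (Finset.mem_insert_of_mem hi))
        rw [this]
        exact hy' j (Finset.mem_insert_self _ _)
      rw [hzero]
      refine ⟨hxs, ?_⟩
      intro w _
      simp
  · intro y' hprop
    have hst : ∃ β : ℝ, 0 < β ∧
        (norm0 xs = s → ∀ j ∉ spt xs, β * |gradL f h xs y' j| < kthLargest xs s) := by
      by_cases hx : norm0 xs = s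
      · obtain ⟨hκ, -⟩ := aux_kth hs0 hsn xs hx
        have hpos : 0 < 1 + ‖gradL f h xs y'‖ := by positivity
        refine ⟨kthLargest xs s / (1 + ‖gradL f h xs y'‖), div_pos hκ hpos, ?_⟩
        intro _ j _
        have h1 : |gradL f h xs y' j| ≤ ‖gradL f h xs y'‖ :=
          PiLp.norm_apply_le (gradL f h xs y') j
        rw [div_mul_eq_mul_div, div_lt_iff₀ hpos]
        exact mul_lt_mul_of_pos_left (by linarith) hκ
      · exact ⟨1, one_pos, fun e => absurd e hx⟩
    obtain ⟨β, hβ, hb⟩ := hst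
    have := (hprop β hβ hb).1
    exact aux_unique f h xs hrank y' y (aux_stat xs _ β hβ this) hy

end
end

section
/- Let f : ℝⁿ → ℝ be convex and twice continuously differentiable and h : ℝⁿ → ℝᵐ be affine. Let β > 0 and suppose x* is a strong β-Lagrangian stationary point of the problem min f(x) subject to h(x) = 0, ‖x‖₀ ≤ s, with multiplier y* ∈ ℝᵐ. If ‖x*‖₀ < s, then x* is a global minimizer: f(x) ≥ f(x*) for all x ∈ ℝⁿ with h(x) = 0 and ‖x‖₀ ≤ s. -/
open scoped BigOperators
open Filter Topology

noncomputable section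

/-- A strong stationary point with slack sparsity has zero Lagrangian gradient. -/
lemma gradL_eq_zero {n m s : ℕ} (f : E n → ℝ) (h : E n → E m)
    (β : ℝ) (hβ : 0 < β) (xs : E n) (ys : E m)
    (hstat : StrongLS s f h β xs ys) (hlt : norm0 xs < s) : gradL f h xs ys = 0 := by
  obtain ⟨⟨-, hmin⟩, -⟩ := hstat
  generalize gradL f h xs ys = g at hmin ⊢
  ext i
  have hw : xs + EuclideanSpace.single i (-(β * g i)) ∈ Sset n s := by
    have hsub : (Finset.univ.filter fun j =>
        (xs + EuclideanSpace.single i (-(β * g i))) j ≠ 0) ⊆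
        insert i (Finset.univ.filter fun j => xs j ≠ 0) := by
      intro j hj
      by_cases hij : j = i
      · simp [hij]
      · simpa [hij] using hj
    have h1 := (Finset.card_le_card hsub).trans (Finset.card_insert_le _ _)
    change norm0 _ ≤ s
    unfold norm0 at hlt ⊢
    omega
  have h2 := hmin _ hw
  have e1 : xs - β • g - xs = -(β • g) := by abel
  have e2 : xs - β • g - (xs + EuclideanSpace.single i (-(β * g i)))
      = -(β • g) - EuclideanSpace.single i (-(β * g i)) := by abel
  rw [e1, e2, norm_sub_sq_real] at h2
  simp [EuclideanSpace.inner_single_right] at h2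
  rw [← abs_mul, sq_abs] at h2
  have h3 : (β * g i) ^ 2 ≤ 0 := by nlinarith
  have h4 : β * g i = 0 := pow_eq_zero_iff two_ne_zero |>.1 (le_antisymm h3 (sq_nonneg _))
  simpa [hβ.ne'] using h4

/-- Gradient inequality, in the form needed here. -/
lemma le_of_gradient {n : ℕ} (f : E n → ℝ) (hf : ContDiff ℝ 2 f)
    (hconv : ConvexOn ℝ Set.univ f) (a x : E n)
    (h0 : fderiv ℝ f a (x - a) = 0) : f a ≤ f x := by
  have hd : HasDerivAt (fun t : ℝ => f (AffineMap.lineMap a x t)) 0 0 := by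
    have h1 : HasFDerivAt f (fderiv ℝ f a) (AffineMap.lineMap a x (0:ℝ)) := by
      simpa using ((hf.differentiable (by norm_num)) a).hasFDerivAt
    have := h1.comp_hasDerivAt (0:ℝ) (AffineMap.hasDerivAt_lineMap (a := a) (b := x) (x := (0:ℝ)))
    rwa [h0] at this
  have hc : ConvexOn ℝ Set.univ (fun t : ℝ => f (AffineMap.lineMap a x t)) := by
    simpa using! hconv.comp_affineMap (AffineMap.lineMap a x)
  have := hc.le_slope_of_hasDerivAt (Set.mem_univ 0) (Set.mem_univ 1) one_pos hd
  simpa [slope_def_field] using this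

/-- Theorem 2.5, global case: for convex `f` and affine `h`, a strong
β-Lagrangian stationary point with `‖x*‖₀ < s` is a global minimizer. -/
theorem statement_4 {n m s : ℕ} (hs0 : 0 < s) (hsn : s < n)
    (f : E n → ℝ) (h : E n → E m) (hf : ContDiff ℝ 2 f)
    (hconv : ConvexOn ℝ Set.univ f)
    (haff : ∃ (A : E n →ₗ[ℝ] E m) (c : E m), ∀ u, h u = A u + c)
    (β : ℝ) (hβ : 0 < β) (xs : E n) (ys : E m)
    (hstat : StrongLS s f h β xs ys) (hlt : norm0 xs < s) :
    ∀ x : E n, h x = 0 → norm0 x ≤ s → f xs ≤ f x := by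
  intro x hx _
  have hg := gradL_eq_zero f h β hβ xs ys hstat hlt
  obtain ⟨A, c, hA⟩ := haff
  have hxs : h xs = 0 := hstat.2
  have hAx : A (x - xs) = 0 := by
    have h1 := hA x
    have h2 := hA xs
    rw [hx] at h1
    rw [hxs] at h2
    rw [map_sub, sub_eq_zero]
    exact add_right_cancel (h1.symm.trans h2)
  have hk : ∀ k, fderiv ℝ (fun u => h u k) xs (x - xs) = 0 := by
    intro k
    have hd : HasFDerivAt (fun u => h u k)
        ((EuclideanSpace.proj k : E m →L[ℝ] ℝ).comp (LinearMap.toContinuousLinearMap A)) xs := by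
      have := ((EuclideanSpace.proj k : E m →L[ℝ] ℝ).comp
        (LinearMap.toContinuousLinearMap A)).hasFDerivAt (x := xs) |>.add_const (c k)
      refine this.congr_of_eventuallyEq (Eventually.of_forall fun u => ?_)
      simp [hA]
    rw [hd.fderiv]
    simp [hAx]
  apply le_of_gradient f hf hconv
  have hin : inner ℝ (gradL f h xs ys) (x - xs) = 0 := by rw [hg, inner_zero_left]
  rw [gradL, inner_sub_left, sum_inner] at hin
  simp only [inner_smul_left, gradient, InnerProductSpace.toDual_symm_apply, hk] at hin
  simpa using hin

end
end

section
/- Let f : ℝⁿ → ℝ be convex and twice continuously differentiable and h : ℝⁿ → ℝᵐ be affine. Let β > 0 and suppose x* is a strong β-Lagrangian stationary point of the problem min f(x) subject to h(x) = 0, ‖x‖₀ ≤ s, with multiplier y* ∈ ℝᵐ. If ‖x*‖₀ = s, then x* is a local minimizer: there exists δ > 0 such that f(x) ≥ f(x*) for all x with ‖x − x*‖ < δ, h(x) = 0 and ‖x‖₀ ≤ s. -/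
open scoped BigOperators
open Filter Topology

noncomputable section

/-- First-order convexity inequality in the direction of zero derivative. -/
theorem aux_convex {n : ℕ} (f : E n → ℝ) (hd : Differentiable ℝ f)
    (hconv : ConvexOn ℝ Set.univ f) (a b : E n) (h0 : fderiv ℝ f a (b - a) = 0) :
    f a ≤ f b := by
  have hc : ConvexOn ℝ Set.univ (f ∘ (AffineMap.lineMap a b : ℝ →ᵃ[ℝ] E n)) := by
    simpa using hconv.comp_affineMap (AffineMap.lineMap a b : ℝ →ᵃ[ℝ] E n)
  have hder : HasDerivAt (f ∘ (AffineMap.lineMap a b : ℝ →ᵃ[ℝ] E n)) 0 0 := by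
    have h1 : HasDerivAt (AffineMap.lineMap a b : ℝ → E n) (b - a) 0 :=
      AffineMap.hasDerivAt_lineMap
    have h2 : HasFDerivAt f (fderiv ℝ f a) ((AffineMap.lineMap a b : ℝ → E n) 0) := by
      simpa using (hd a).hasFDerivAt
    have h3 := h2.comp_hasDerivAt (0 : ℝ) h1
    rwa [h0] at h3
  have := hc.le_slope_of_hasDerivAt (Set.mem_univ 0) (Set.mem_univ 1) zero_lt_one hder
  simpa [slope_def_field] using this

theorem aux_grad_s5 {n m s : ℕ} (f : E n → ℝ) (h : E n → E m)
    (β : ℝ) (hβ : 0 < β) (xs : E n) (ys : E m)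
    (hstat : StrongLS s f h β xs ys) (i : Fin n) (hi : xs i ≠ 0) :
    gradL f h xs ys i = 0 := by
  obtain ⟨⟨hS, hmin⟩, -⟩ := hstat
  generalize gradL f h xs ys = g at *
  have hw : xs - (β * g i) • EuclideanSpace.single i (1 : ℝ) ∈ Sset n s := by
    refine le_trans (Finset.card_le_card ?_) hS
    intro j hj
    simp only [Finset.mem_filter, Finset.mem_univ, true_and] at hj ⊢
    by_cases hji : j = i
    · rwa [hji]
    · simpa [hji] using hj
  have h1 := hmin _ hw
  rw [EuclideanSpace.norm_sq_eq, EuclideanSpace.norm_sq_eq] at h1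
  rw [← Finset.add_sum_erase _ _ (Finset.mem_univ i),
    ← Finset.add_sum_erase (f := fun j => ‖(xs - β • g - (xs - (β * g i) •
      EuclideanSpace.single i (1 : ℝ))) j‖ ^ 2) _ (Finset.mem_univ i)] at h1
  have h2 : ∑ j ∈ Finset.univ.erase i, ‖(xs - β • g - (xs - (β * g i) •
      EuclideanSpace.single i (1 : ℝ))) j‖ ^ 2
      = ∑ j ∈ Finset.univ.erase i, ‖(xs - β • g - xs) j‖ ^ 2 := by
    refine Finset.sum_congr rfl fun j hj => ?_
    have : j ≠ i := Finset.ne_of_mem_erase hj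
    simp [this]
  rw [h2] at h1
  have h3 : ‖(xs - β • g - xs) i‖ ^ 2 = (β * g i) ^ 2 := by simp [mul_pow]
  have h4 : ‖(xs - β • g - (xs - (β * g i) • EuclideanSpace.single i (1 : ℝ))) i‖ ^ 2 = 0 := by
    simp
  rw [h3, h4] at h1
  have h5 : (β * g i) ^ 2 = 0 := le_antisymm (by linarith) (sq_nonneg _)
  have h6 := pow_eq_zero_iff (two_ne_zero) |>.1 h5
  exact (mul_eq_zero.1 h6).resolve_left (ne_of_gt hβ)

/-- Theorem 2.5, local case: for convex `f` and affine `h`, a strong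
β-Lagrangian stationary point with `‖x*‖₀ = s` is a local minimizer. -/
theorem statement_5 {n m s : ℕ} (hs0 : 0 < s) (hsn : s < n)
    (f : E n → ℝ) (h : E n → E m) (hf : ContDiff ℝ 2 f)
    (hconv : ConvexOn ℝ Set.univ f)
    (haff : ∃ (A : E n →ₗ[ℝ] E m) (c : E m), ∀ u, h u = A u + c)
    (β : ℝ) (hβ : 0 < β) (xs : E n) (ys : E m)
    (hstat : StrongLS s f h β xs ys) (heq : norm0 xs = s) :
    ∃ δ > 0, ∀ x : E n, ‖x - xs‖ < δ → h x = 0 → norm0 x ≤ s → f xs ≤ f x := by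
  have hh : h xs = 0 := hstat.2
  have hev : ∀ᶠ x in 𝓝 xs, ∀ i, xs i ≠ 0 → x i ≠ 0 := by
    rw [eventually_all]
    intro i
    by_cases hi : xs i = 0
    · simp [hi]
    · have hc : Continuous fun x : E n => x i := by fun_prop
      filter_upwards [hc.continuousAt.eventually_ne hi] with x hx _ using hx
  obtain ⟨δ, hδ, hball⟩ := Metric.eventually_nhds_iff.1 hev
  refine ⟨δ, hδ, fun x hx hx0 hxs => ?_⟩
  have hne := hball (by rwa [dist_eq_norm])
  have hsub : (Finset.univ.filter fun i => xs i ≠ 0) ⊆ Finset.univ.filter fun i => x i ≠ 0 := by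
    intro j hj
    simp only [Finset.mem_filter, Finset.mem_univ, true_and] at hj ⊢
    exact hne j hj
  have hsupp := Finset.eq_of_subset_of_card_le hsub (by
    change norm0 x ≤ norm0 xs
    rw [heq]; exact hxs)
  have hz : ∀ i, xs i = 0 → x i = 0 := by
    intro i hi
    by_contra hxi
    have : i ∈ Finset.univ.filter fun i => xs i ≠ 0 := by
      rw [hsupp]; simpa using hxi
    simp [hi] at this
  have hd : Differentiable ℝ f := hf.differentiable (by norm_num)
  have hg0 : inner ℝ (gradL f h xs ys) (x - xs) = 0 := by
    rw [PiLp.inner_apply]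
    refine Finset.sum_eq_zero fun i _ => ?_
    by_cases hi : xs i = 0
    · simp [hi, hz i hi]
    · simp [aux_grad_s5 f h β hβ xs ys hstat i hi]
  obtain ⟨A, c, hA⟩ := haff
  have hk : ∀ k, inner ℝ (gradient (fun u => h u k) xs) (x - xs) = 0 := by
    intro k
    have hfd : HasFDerivAt (fun u => h u k)
        ((EuclideanSpace.proj k : E m →L[ℝ] ℝ).comp (LinearMap.toContinuousLinearMap A)) xs := by
      have e : (fun u => h u k) = fun u =>
          ((EuclideanSpace.proj k : E m →L[ℝ] ℝ).comp (LinearMap.toContinuousLinearMap A)) u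
            + c k := by
        funext u; simp [hA]
      rw [e]
      exact (ContinuousLinearMap.hasFDerivAt _).add_const _
    rw [gradient, InnerProductSpace.toDual_symm_apply, hfd.fderiv]
    have h1 : A (x - xs) = 0 := by
      have : A (x - xs) = h x - h xs := by rw [hA, hA, map_sub]; abel
      rw [this, hx0, hh, sub_zero]
    simp [← map_sub, h1]
  refine aux_convex f hd hconv xs x ?_
  rw [gradL, inner_sub_left, sum_inner] at hg0
  simp only [inner_smul_left, hk, mul_zero, Finset.sum_const_zero, sub_zero] at hg0
  rwa [gradient, InnerProductSpace.toDual_symm_apply] at hg0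

end
end

section
/- For any (x, y) ∈ ℝⁿ × ℝᵐ and any index set T ⊆ {1,…,n} with |T| = s, the (n+m)×(n+m) Jacobian matrix ∇_{(x,y)} F(x, y; T) is nonsingular if and only if the (s+m)×(s+m) reduced Jacobian matrix G(x, y; T) is nonsingular. -/
open scoped BigOperators
open Filter Topology

noncomputable section

/-- the `(n+m)×(n+m)` Jacobian `∇_{(x,y)}F(x,y;T)` is nonsingular iff the
`(s+m)×(s+m)` reduced Jacobian `G(x,y;T)` is nonsingular. -/
theorem statement_8 {n m s : ℕ} (hs0 : 0 < s) (hsn : s < n)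
    (f : E n → ℝ) (h : E n → E m) (hf : ContDiff ℝ 2 f) (hh : ContDiff ℝ 2 h)
    (x : E n) (y : E m) (T : Finset (Fin n)) (hT : T.card = s) :
    (JacF f h T x y).det ≠ 0 ↔ (Gmat f h T x y).det ≠ 0 := by
  classical
  let p : Fin n ⊕ Fin m → Prop := Sum.elim (fun i => i ∈ T) (fun _ => True)
  have key := Matrix.twoBlockTriangular_det (JacF f h T x y) p (by
    rintro (i | k) hi (j | l) hj
    · have hi' : i ∉ T := hi
      have hj' : j ∈ T := hj
      have hij : i ≠ j := fun hh => hi' (hh ▸ hj')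
      simp [JacF, hi', hij]
    · have hi' : i ∉ T := hi
      simp [JacF, hi']
    · exact absurd trivial hi
    · exact absurd trivial hi)
  have h1 : (Matrix.toSquareBlockProp (JacF f h T x y) (fun i => ¬ p i)) = 1 := by
    ext ⟨r, hr⟩ ⟨c, hc⟩
    rcases r with i | k
    · rcases c with j | l
      · have hi' : i ∉ T := hr
        simp [Matrix.toSquareBlockProp, JacF, hi', Matrix.one_apply]
      · exact absurd trivial hc
    · exact absurd trivial hr
  let e : ({i // i ∈ T} ⊕ Fin m) ≃ {r // p r} :=
    { toFun := fun r => match r with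
        | Sum.inl i => ⟨Sum.inl i.1, i.2⟩
        | Sum.inr k => ⟨Sum.inr k, trivial⟩
      invFun := fun r => match r with
        | ⟨Sum.inl i, hi⟩ => Sum.inl ⟨i, hi⟩
        | ⟨Sum.inr k, _⟩ => Sum.inr k
      left_inv := by rintro (i | k) <;> rfl
      right_inv := by rintro ⟨i | k, hr⟩ <;> rfl }
  have h2 : Gmat f h T x y = (Matrix.toSquareBlockProp (JacF f h T x y) p).submatrix e e := by
    ext r c
    rcases r with i | k <;> rcases c with j | l <;>
      simp [Matrix.toSquareBlockProp, JacF, Gmat, e]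
  rw [key, h1, Matrix.det_one, mul_one, h2, Matrix.det_submatrix_equiv_self]


end
end

section
/- Let β > 0 and let x* ≠ 0 be a strong β-Lagrangian stationary point with multiplier y*, Γ* = supp(x*), q* = ∇_x L(x*, y*). Suppose there exist δ₀ > 0 and L₁ > 0 such that ‖∇_x L(x,y) − ∇_x L(x̂,ŷ)‖ ≤ L₁‖(x;y) − (x̂;ŷ)‖ for all (x;y), (x̂;ŷ) in the ball of radius δ₀ around z* = (x*; y*). Set δ₁ = (min_{i ∈ Γ*}|x*_i| − β max_{i ∉ Γ*}|q*_i|) / (√2 (1 + βL₁)) and δ* = min{δ₀, δ₁}. Then for every z = (x; y) with ‖x‖₀ ≤ s and ‖z − z*‖ < δ*: 𝕋(x, y; β) ⊆ 𝕋(x*, y*; β), and Γ* ⊆ supp(x) ∩ T for every T ∈ 𝕋(x, y; β). -/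
open scoped BigOperators
open Filter Topology

noncomputable section

lemma aux_qzero {n s : ℕ} (β : ℝ) (hβ : 0 < β) (xs q : E n)
    (hp : xs ∈ projS n s (xs - β • q)) (i : Fin n)
    (hi : i ∈ spt xs ∨ (spt xs).card < s) : q i = 0 := by
  obtain ⟨hS, hmin⟩ := hp
  have hS' : (spt xs).card ≤ s := hS
  have hw : xs - EuclideanSpace.single i (β * q i) ∈ Sset n s := by
    have hsub : spt (xs - EuclideanSpace.single i (β * q i)) ⊆ insert i (spt xs) := by
      intro j hj
      by_cases hji : j = i
      · simp [hji]
      · have : (xs - EuclideanSpace.single i (β * q i)) j ≠ 0 := by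
          simpa [spt] using hj
        have h2 : xs j ≠ 0 := by simpa [hji] using this
        simp [spt, h2]
    have hc := Finset.card_le_card hsub
    have : (spt (xs - EuclideanSpace.single i (β * q i))).card ≤ s := by
      rcases hi with hi | hi
      · rw [Finset.insert_eq_of_mem hi] at hc
        omega
      · have := Finset.card_insert_le i (spt xs)
        omega
    exact this
  have h1 := hmin _ hw
  have e1 : xs - β • q - xs = -(β • q) := by abel
  have e2 : xs - β • q - (xs - EuclideanSpace.single i (β * q i))
      = -(β • q) + EuclideanSpace.single i (β * q i) := by abel
  rw [e1, e2, norm_add_sq_real] at h1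
  have e3 : inner ℝ (-(β • q)) (EuclideanSpace.single i (β * q i)) = -(β * q i) ^ 2 := by
    rw [EuclideanSpace.inner_single_right]
    simp
    ring
  rw [e3] at h1
  have e4 : ‖(EuclideanSpace.single i (β * q i) : E n)‖ ^ 2 = (β * q i) ^ 2 := by
    simp [mul_pow]
  rw [e4] at h1
  have h2 : (β * q i) ^ 2 = 0 := le_antisymm (by linarith) (sq_nonneg _)
  have h3 : β * q i = 0 := by simpa using h2
  rcases mul_eq_zero.mp h3 with h4 | h4
  · exact absurd h4 hβ.ne'
  · exact h4

lemma aux_two {n : ℕ} (a : E n) (i j : Fin n) (hij : i ≠ j) :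
    |a i| + |a j| ≤ Real.sqrt 2 * ‖a‖ := by
  have h1 : a i ^ 2 + a j ^ 2 ≤ ‖a‖ ^ 2 := by
    rw [EuclideanSpace.real_norm_sq_eq]
    rw [← Finset.sum_pair (f := fun k => a k ^ 2) hij]
    exact Finset.sum_le_sum_of_subset_of_nonneg (Finset.subset_univ _)
      (fun _ _ _ => sq_nonneg _)
  apply abs_le_of_sq_le_sq' _ (by positivity) |>.2
  rw [mul_pow, Real.sq_sqrt (by norm_num)]
  nlinarith [sq_abs (a i), sq_abs (a j), sq_nonneg (|a i| - |a j|)]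

/-- Lemma 3.6, first part: invariance of the index sets near a strong
β-Lagrangian stationary point `x* ≠ 0`.  Here `min_{i∈Γ*}|x*_i|` and `max_{i∉Γ*}|q*_i|`
are written as `sInf`/`sSup` of the corresponding (finite) image sets. -/
theorem statement_10 {n m s : ℕ} (hs0 : 0 < s) (hsn : s < n)
    (f : E n → ℝ) (h : E n → E m) (hf : ContDiff ℝ 2 f) (hh : ContDiff ℝ 2 h)
    (β : ℝ) (hβ : 0 < β) (xs : E n) (ys : E m) (hx0 : xs ≠ 0)
    (hstat : StrongLS s f h β xs ys)
    (δ₀ L₁ : ℝ) (hδ₀ : 0 < δ₀) (hL₁ : 0 < L₁)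
    (hLip : ∀ (x x' : E n) (y y' : E m), zNorm (x - xs) (y - ys) < δ₀ →
      zNorm (x' - xs) (y' - ys) < δ₀ →
      ‖gradL f h x y - gradL f h x' y'‖ ≤ L₁ * zNorm (x - x') (y - y'))
    (δstar : ℝ)
    (hδstar : δstar = min δ₀
      ((sInf ((fun i => |xs i|) '' (spt xs : Set (Fin n))) -
        β * sSup ((fun j => |gradL f h xs ys j|) '' ((spt xs : Set (Fin n))ᶜ))) /
        (Real.sqrt 2 * (1 + β * L₁)))) :
    ∀ (x : E n) (y : E m), norm0 x ≤ s → zNorm (x - xs) (y - ys) < δstar →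
      Tsets s f h β x y ⊆ Tsets s f h β xs ys ∧
      ∀ T ∈ Tsets s f h β x y, spt xs ⊆ spt x ∩ T := by
  intro x y _ hz
  have hz0 : zNorm (x - xs) (y - ys) < δ₀ := by
    rw [hδstar] at hz
    exact lt_of_lt_of_le hz (min_le_left _ _)
  have hz1 := lt_of_lt_of_le (hδstar ▸ hz) (min_le_right _ _)
  have hnn : 0 ≤ zNorm (x - xs) (y - ys) := Real.sqrt_nonneg _
  have hxz : ‖x - xs‖ ≤ zNorm (x - xs) (y - ys) :=
    Real.le_sqrt_of_sq_le (by nlinarith [sq_nonneg ‖y - ys‖])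
  have hK : 0 < Real.sqrt 2 * (1 + β * L₁) := by positivity
  have hL := hLip x xs y ys hz0 (by simpa [zNorm] using hδ₀)
  have hqz := aux_qzero β hβ xs (gradL f h xs ys) hstat.1
  have hcard : (spt xs).card ≤ s := hstat.1.1
  rw [lt_div_iff₀ hK] at hz1
  set q := gradL f h xs ys with hq
  set p := gradL f h x y with hp
  set Z := zNorm (x - xs) (y - ys) with hZ
  set A := sInf ((fun i => |xs i|) '' (spt xs : Set (Fin n))) with hA
  set B := sSup ((fun j => |q j|) '' ((spt xs : Set (Fin n))ᶜ)) with hB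
  have hAle : ∀ i ∈ spt xs, A ≤ |xs i| := fun i hi =>
    csInf_le ((Set.toFinite _).bddBelow) (Set.mem_image_of_mem _ hi)
  have hBle : ∀ j ∉ spt xs, |q j| ≤ B := fun j hj =>
    le_csSup ((Set.toFinite _).bddAbove) (Set.mem_image_of_mem (fun j => |q j|) (by simpa using hj))
  have hB0 : 0 ≤ B := Real.sSup_nonneg (by
    rintro _ ⟨j, _, rfl⟩
    exact abs_nonneg _)
  have hxs0 : ∀ j ∉ spt xs, xs j = 0 := fun j hj => by simpa [spt] using hj
  have hu : ‖(x - β • p) - (xs - β • q)‖ ≤ (1 + β * L₁) * Z := by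
    have e : (x - β • p) - (xs - β • q) = (x - xs) - β • (p - q) := by
      rw [smul_sub]; abel
    rw [e]
    refine (norm_sub_le _ _).trans ?_
    rw [norm_smul, Real.norm_of_nonneg hβ.le]
    nlinarith [mul_le_mul_of_nonneg_left hL hβ.le]
  have key : ∀ i ∈ spt xs, ∀ j ∉ spt xs, |(x - β • p) j| < |(x - β • p) i| := by
    intro i hi j hj
    have hij : i ≠ j := fun e => hj (e ▸ hi)
    have h2 := aux_two ((x - β • p) - (xs - β • q)) i j hij
    have h3 := mul_le_mul_of_nonneg_left hu (Real.sqrt_nonneg 2)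
    have ei : (xs - β • q) i = xs i := by simp [hqz i (Or.inl hi)]
    have ej : |(xs - β • q) j| = β * |q j| := by simp [hxs0 j hj, abs_mul, abs_of_pos hβ]
    have h4 := abs_sub_abs_le_abs_sub ((xs - β • q) i) ((x - β • p) i)
    have h5 := abs_sub_abs_le_abs_sub ((x - β • p) j) ((xs - β • q) j)
    rw [abs_sub_comm] at h4
    rw [ei] at h4
    rw [ej] at h5
    have es : ∀ k, ((x - β • p) - (xs - β • q)) k = (x - β • p) k - (xs - β • q) k :=
      fun _ => rfl
    rw [es i, es j, ei] at h2
    have h6 := hAle i hi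
    have h7 := mul_le_mul_of_nonneg_left (hBle j hj) hβ.le
    linarith
  have hsubT : ∀ T ∈ Tsets s f h β x y, spt xs ⊆ T := by
    rintro T ⟨hT, hT2⟩ i hi
    by_contra hiT
    have : ∃ j ∈ T, j ∉ spt xs := by
      by_contra! hc
      have := Finset.eq_of_subset_of_card_le (s := T) hc (by omega)
      exact hiT (this ▸ hi)
    obtain ⟨j, hjT, hj⟩ := this
    exact absurd (hT2 j hjT i hiT) (not_le.mpr (key i hi j hj))
  have hβB : 0 ≤ β * B := mul_nonneg hβ.le hB0
  refine ⟨?_, ?_⟩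
  · intro T hT
    have hsub := hsubT T hT
    refine ⟨hT.1, fun i hi j hj => ?_⟩
    have hj' : j ∉ spt xs := fun hc => hj (hsub hc)
    rw [← hq]
    have ej : |(xs - β • q) j| = β * |q j| := by simp [hxs0 j hj', abs_mul, abs_of_pos hβ]
    rw [ej]
    rcases hcard.lt_or_eq with hlt | heq
    · rw [hqz j (Or.inr hlt)]
      simp
    · have hTe := Finset.eq_of_subset_of_card_le hsub (by rw [heq, hT.1])
      rw [← hTe] at hi
      have ei : (xs - β • q) i = xs i := by simp [hqz i (Or.inl hi)]
      rw [ei]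
      have h6 := hAle i hi
      have h7 := mul_le_mul_of_nonneg_left (hBle j hj') hβ.le
      nlinarith [mul_nonneg hnn hK.le]
  · intro T hT i hi
    refine Finset.mem_inter.mpr ⟨?_, hsubT T hT hi⟩
    by_contra hc
    have hxi : x i = 0 := by simpa [spt] using hc
    have h1 : |xs i| ≤ ‖x - xs‖ := by
      simpa [hxi] using PiLp.norm_apply_le (x - xs) i
    have h6 := hAle i hi
    have h8 : 1 ≤ Real.sqrt 2 * (1 + β * L₁) := by
      have a1 : 1 ≤ Real.sqrt 2 := Real.one_le_sqrt.mpr (by norm_num)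
      have a2 : 1 ≤ 1 + β * L₁ := by nlinarith [mul_pos hβ hL₁]
      exact one_le_mul_of_one_le_of_one_le a1 a2
    have h9 := mul_le_mul_of_nonneg_left h8 hnn
    linarith

end
end

section
/- Consider the compressed sensing problem: minimize (1/2)‖Ax − b‖² subject to Cx = d and ‖x‖₀ ≤ s, with A ∈ ℝ^{(p−m)×n}, C ∈ ℝ^{m×n}, b ∈ ℝ^{p−m}, d ∈ ℝᵐ. If the feasible set {x ∈ ℝⁿ : Cx = d, ‖x‖₀ ≤ s} is nonempty, then the problem has an optimal solution, i.e., there exists x* in the feasible set with (1/2)‖Ax* − b‖² ≤ (1/2)‖Ax − b‖² for all feasible x. -/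
open scoped BigOperators
open Filter Topology

noncomputable section

/-- A linear least-squares problem over a translate of a subspace attains its minimum. -/
theorem exists_min_affine {V F : Type*} [AddCommGroup V] [Module ℝ V]
    [NormedAddCommGroup F] [InnerProductSpace ℝ F] [FiniteDimensional ℝ F]
    (L : V →ₗ[ℝ] F) (W : Submodule ℝ V) (x0 : V) (b : F) :
    ∃ w ∈ W, ∀ v ∈ W, ‖L (x0 + w) - b‖ ≤ ‖L (x0 + v) - b‖ := by
  have hc : IsClosed ((W.map L : Submodule ℝ F) : Set F) :=
    Submodule.closed_of_finiteDimensional _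
  obtain ⟨u, hu, hd⟩ := hc.exists_infDist_eq_dist ⟨0, (W.map L).zero_mem⟩ (b - L x0)
  obtain ⟨w, hw, rfl⟩ := hu
  refine ⟨w, hw, fun v hv => ?_⟩
  have h1 := Metric.infDist_le_dist_of_mem (x := b - L x0)
    (show L v ∈ ((W.map L : Submodule ℝ F) : Set F) from ⟨v, hv, rfl⟩)
  rw [hd, dist_comm, dist_comm _ (L v), dist_eq_norm, dist_eq_norm] at h1
  have e : ∀ z : V, L (x0 + z) - b = L z - (b - L x0) := by
    intro z
    rw [map_add]
    abel
  rw [e, e]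
  exact h1

/-- The least-squares problem on a fixed coordinate subspace attains its minimum. -/
theorem exists_min_support {n q m : ℕ} (A : Matrix (Fin q) (Fin n) ℝ)
    (C : Matrix (Fin m) (Fin n) ℝ) (b : E q) (d : Fin m → ℝ) (J : Finset (Fin n))
    (x0 : E n) (h0 : C.mulVec (fun i => x0 i) = d) (hJ0 : ∀ i ∉ J, x0 i = 0) :
    ∃ y : E n, (C.mulVec (fun i => y i) = d ∧ ∀ i ∉ J, y i = 0) ∧
      ∀ x : E n, C.mulVec (fun i => x i) = d → (∀ i ∉ J, x i = 0) →
        ‖toE (A.mulVec fun i => y i) - b‖ ≤ ‖toE (A.mulVec fun i => x i) - b‖ := by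
  let L : (Fin n → ℝ) →ₗ[ℝ] E q :=
    (WithLp.linearEquiv 2 ℝ (Fin q → ℝ)).symm.toLinearMap ∘ₗ A.mulVecLin
  let W : Submodule ℝ (Fin n → ℝ) :=
    { carrier := {v | C.mulVec v = 0 ∧ ∀ i ∉ J, v i = 0}
      zero_mem' := by simp
      add_mem' := by
        rintro u v ⟨hu, hu'⟩ ⟨hv, hv'⟩
        refine ⟨by rw [Matrix.mulVec_add, hu, hv, add_zero], fun i hi => ?_⟩
        simp [hu' i hi, hv' i hi]
      smul_mem' := by
        rintro c v ⟨hv, hv'⟩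
        refine ⟨by rw [Matrix.mulVec_smul, hv, smul_zero], fun i hi => ?_⟩
        simp [hv' i hi] }
  obtain ⟨w, ⟨hw, hw'⟩, hmin⟩ := exists_min_affine L W (fun i => x0 i) b
  refine ⟨toE ((fun i => x0 i) + w), ⟨?_, fun i hi => ?_⟩, fun x hx hx' => ?_⟩
  · change C.mulVec ((fun i => x0 i) + w) = d
    rw [Matrix.mulVec_add, h0, hw, add_zero]
  · change x0 i + w i = 0
    rw [hJ0 i hi, hw' i hi, add_zero]
  · have := hmin ((fun i => x i) - (fun i => x0 i)) ⟨by
      rw [Matrix.mulVec_sub, hx, h0, sub_self], fun i hi => by simp [hx' i hi, hJ0 i hi]⟩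
    rw [add_sub_cancel] at this
    exact this

/-- Proposition 5.2, existence part: the sparse compressed-sensing problem
`min ½‖Ax - b‖²  s.t.  Cx = d, ‖x‖₀ ≤ s` attains its minimum whenever it is feasible. -/
theorem statement_16 {n p m s : ℕ} (hs0 : 0 < s) (hsn : s < n)
    (A : Matrix (Fin (p - m)) (Fin n) ℝ) (C : Matrix (Fin m) (Fin n) ℝ)
    (b : E (p - m)) (d : Fin m → ℝ)
    (hfeas : ∃ x : E n, C.mulVec (fun i => x i) = d ∧ norm0 x ≤ s) :
    ∃ xs : E n, (C.mulVec (fun i => xs i) = d ∧ norm0 xs ≤ s) ∧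
      ∀ x : E n, C.mulVec (fun i => x i) = d → norm0 x ≤ s →
        (1 / 2) * ‖toE (A.mulVec fun i => xs i) - b‖ ^ 2 ≤
        (1 / 2) * ‖toE (A.mulVec fun i => x i) - b‖ ^ 2 := by
  classical
  let P : Finset (Fin n) → Prop := fun J => J.card ≤ s ∧
    ∃ x : E n, C.mulVec (fun i => x i) = d ∧ ∀ i ∉ J, x i = 0
  have key : ∀ J : Finset (Fin n), ∃ y : E n, P J →
      ((C.mulVec (fun i => y i) = d ∧ ∀ i ∉ J, y i = 0) ∧
      ∀ x : E n, C.mulVec (fun i => x i) = d → (∀ i ∉ J, x i = 0) →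
        ‖toE (A.mulVec fun i => y i) - b‖ ≤ ‖toE (A.mulVec fun i => x i) - b‖) := by
    intro J
    by_cases hP : P J
    · obtain ⟨-, x0, h0, hJ0⟩ := id hP
      obtain ⟨y, hy⟩ := exists_min_support A C b d J x0 h0 hJ0
      exact ⟨y, fun _ => hy⟩
    · exact ⟨0, fun h => absurd h hP⟩
  choose y hy using key
  have hspt : ∀ x : E n, ∀ i ∉ spt x, x i = 0 := by
    intro x i hi
    simpa [spt] using hi
  have hPs : ∀ x : E n, C.mulVec (fun i => x i) = d → norm0 x ≤ s → P (spt x) :=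
    fun x hx hxs => ⟨hxs, x, hx, hspt x⟩
  obtain ⟨x0, h0, h0s⟩ := hfeas
  obtain ⟨J, hJ, hmin⟩ := Finset.exists_min_image (Finset.univ.filter P)
    (fun J => ‖toE (A.mulVec fun i => y J i) - b‖)
    ⟨spt x0, Finset.mem_filter.2 ⟨Finset.mem_univ _, hPs x0 h0 h0s⟩⟩
  have hPJ : P J := (Finset.mem_filter.1 hJ).2
  refine ⟨y J, ⟨(hy J hPJ).1.1, ?_⟩, fun x hx hxs => ?_⟩
  · refine le_trans (Finset.card_le_card fun i hi => ?_) hPJ.1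
    by_contra hc
    exact (Finset.mem_filter.1 hi).2 ((hy J hPJ).1.2 i hc)
  · have h1 := hmin (spt x) (Finset.mem_filter.2 ⟨Finset.mem_univ _, hPs x hx hxs⟩)
    have h2 := (hy _ (hPs x hx hxs)).2 x hx (hspt x)
    have h3 := h1.trans h2
    gcongr

end
end

section
/- Consider the compressed sensing problem: minimize f(x) = (1/2)‖Ax − b‖² subject to h(x) = Cx − d = 0 and ‖x‖₀ ≤ s. Let β > 0 and let x* be a strong β-Lagrangian stationary point with multiplier y* ∈ ℝᵐ. If ‖x*‖₀ < s, then x* is a global optimal solution: (1/2)‖Ax* − b‖² ≤ (1/2)‖Ax − b‖² for every x with Cx = d and ‖x‖₀ ≤ s. -/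
open scoped BigOperators
open Filter Topology

noncomputable section

/-- The matrix map as a continuous linear map. -/
def matCLM {q n : ℕ} (A : Matrix (Fin q) (Fin n) ℝ) : E n →L[ℝ] E q :=
  LinearMap.toContinuousLinearMap
    { toFun := fun x => toE (A.mulVec fun i => x i)
      map_add' := fun x y => by
        ext k
        simp [toE, Matrix.mulVec, dotProduct, mul_add, Finset.sum_add_distrib]
      map_smul' := fun c x => by
        ext k
        simp [toE, Matrix.mulVec, dotProduct, Finset.mul_sum, mul_left_comm] }

theorem matCLM_apply {q n : ℕ} (A : Matrix (Fin q) (Fin n) ℝ) (x : E n) :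
    matCLM A x = toE (A.mulVec fun i => x i) := rfl

theorem proj_zero {n s : ℕ} (xs g : E n) (β : ℝ) (hβ : 0 < β) (hlt : norm0 xs < s)
    (hp : xs ∈ projS n s (xs - β • g)) : g = 0 := by
  ext i
  set w : E n := xs + EuclideanSpace.single i (-(β * g i)) with hw
  have hwS : w ∈ Sset n s := by
    have hsub : (Finset.univ.filter fun j => w j ≠ 0) ⊆
        insert i (Finset.univ.filter fun j => xs j ≠ 0) := by
      intro j hj
      by_cases hji : j = i
      · simp [hji]
      · simp only [Finset.mem_filter, Finset.mem_univ, true_and, Finset.mem_insert] at hj ⊢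
        right
        simpa [hw, hji] using hj
    have h1 := Finset.card_le_card hsub
    have h2 := Finset.card_insert_le i (Finset.univ.filter fun j => xs j ≠ 0)
    have : norm0 w ≤ s := by
      unfold norm0 at *
      omega
    exact this
  have h := hp.2 w hwS
  have e1 : xs - β • g - xs = -(β • g) := by abel
  have e2 : xs - β • g - w = -(β • g) + EuclideanSpace.single i (β * g i) := by
    rw [hw]
    ext j
    by_cases hji : j = i
    · subst hji
      simp
      ring
    · simp [hji]
  rw [e1, e2, norm_add_sq_real, EuclideanSpace.inner_single_right] at h
  simp only [EuclideanSpace.norm_single, Real.norm_eq_abs, sq_abs] at h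
  simp at h
  have h3 : (β * g i) ^ 2 ≤ 0 := by nlinarith
  have h4 : β * g i = 0 := by nlinarith [pow_eq_zero_iff (two_ne_zero) |>.1 (le_antisymm h3 (sq_nonneg _))]
  simpa [hβ.ne'] using h4

theorem inner_grad {n : ℕ} {f : E n → ℝ} {x : E n} {f' : E n →L[ℝ] ℝ}
    (h : HasFDerivAt f f' x) (v : E n) : inner ℝ (gradient f x) v = f' v := by
  rw [gradient, h.fderiv, InnerProductSpace.toDual_symm_apply]

/-- Proposition 5.2, global case: for the compressed-sensing problem, a
strong β-Lagrangian stationary point with `‖x*‖₀ < s` is a global optimal solution. -/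
theorem statement_17 {n p m s : ℕ} (hs0 : 0 < s) (hsn : s < n)
    (A : Matrix (Fin (p - m)) (Fin n) ℝ) (C : Matrix (Fin m) (Fin n) ℝ)
    (b : E (p - m)) (d : E m)
    (β : ℝ) (hβ : 0 < β) (xs : E n) (ys : E m)
    (hstat : StrongLS s
      (fun x => (1 / 2) * ‖toE (A.mulVec fun i => x i) - b‖ ^ 2)
      (fun x => toE (C.mulVec fun i => x i) - d) β xs ys)
    (hlt : norm0 xs < s) :
    ∀ x : E n, toE (C.mulVec fun i => x i) - d = 0 → norm0 x ≤ s →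
      (1 / 2) * ‖toE (A.mulVec fun i => xs i) - b‖ ^ 2 ≤
      (1 / 2) * ‖toE (A.mulVec fun i => x i) - b‖ ^ 2 := by
  intro x hx _
  obtain ⟨hp, hx0⟩ := hstat
  have hg := proj_zero _ _ _ hβ hlt hp
  simp only [← matCLM_apply] at *
  have hNv : matCLM C (x - xs) = 0 := by
    rw [map_sub, sub_eq_zero.1 hx, sub_eq_zero.1 hx0, sub_self]
  have hin : inner ℝ (gradient (fun x => (1 / 2) * ‖matCLM A x - b‖ ^ 2) xs) (x - xs) = 0 := by
    rw [gradL, sub_eq_zero] at hg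
    rw [hg, sum_inner]
    refine Finset.sum_eq_zero fun k _ => ?_
    have hk : HasFDerivAt (fun u => (matCLM C u - d) k)
        ((EuclideanSpace.proj k : E m →L[ℝ] ℝ).comp (matCLM C)) xs :=
      (EuclideanSpace.proj k : E m →L[ℝ] ℝ).hasFDerivAt.comp xs
        ((matCLM C).hasFDerivAt.sub_const d)
    rw [inner_smul_left, inner_grad hk]
    simp [hNv]
  have hf : HasFDerivAt (fun x => (1 / 2) * ‖matCLM A x - b‖ ^ 2) _ xs :=
    (((matCLM A).hasFDerivAt (x := xs)).sub_const b).norm_sq.const_mul (1 / 2 : ℝ)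
  rw [inner_grad hf] at hin
  have hin2 : inner ℝ (matCLM A xs - b) (matCLM A (x - xs)) = 0 := by
    simpa [-map_sub] using hin
  have e : matCLM A x - b = (matCLM A xs - b) + matCLM A (x - xs) := by
    rw [map_sub]; abel
  rw [e, norm_add_sq_real, hin2]
  nlinarith [sq_nonneg ‖matCLM A (x - xs)‖]

end
end
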